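/- arXiv:1910.12812 — 2 statements merged into one kernel-verified Lean document; each statement's English description precedes it below -/
import Mathlib

section
/- The 8-dimensional stratified Lie algebra 𝔤 of step 3 defined below contains uncountably many Carnot subalgebras of dimension 7 that are pairwise non-isomorphic as Lie algebras. -/
/-!
Statement 0: the Lie subalgebra of the 8-dimensional stratified Lie algebra 𝔤
generated by `W¹ = span {X₁, X₂ + λ X₀, X₃}` is a 7-dimensional Carnot subalgebra
of step 3 with first stratum `W¹`, isomorphic as a stratified Lie algebra to `𝔤_λ`.
-/

open Module

/-- The span of all brackets of elements of two submodules of a Lie algebra. -/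
def bracketSpan {L : Type*} [LieRing L] [LieAlgebra ℝ L] (A B : Submodule ℝ L) :
    Submodule ℝ L :=
  Submodule.span ℝ {z : L | ∃ x ∈ A, ∃ y ∈ B, z = ⁅x, y⁆}

/-- `V` is a stratification of step `s` of the real Lie algebra `L`:
`L = V 0 ⊕ ⋯ ⊕ V (s-1)`, `V (i+1) = ⁅V 0, V i⁆` for all `i` (in particular
`⁅V 0, V (s-1)⁆ = 0`, since `V i = ⊥` for `i ≥ s`), and `V (s-1) ≠ ⊥`. -/
structure IsStratification (L : Type*) [LieRing L] [LieAlgebra ℝ L]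
    (s : ℕ) (V : ℕ → Submodule ℝ L) : Prop where
  indep : iSupIndep V
  supEq : (⨆ i, V i) = ⊤
  last_ne_bot : V (s - 1) ≠ ⊥
  bot_of_ge : ∀ i, s ≤ i → V i = ⊥
  step : ∀ i, V (i + 1) = bracketSpan (V 0) (V i)

/-- Structure constants of the 8-dimensional step-3 Carnot algebra 𝔤, with respect to an
(ordered) basis `(X₀, X₁, …, X₇)`:  `[X₁,X₂] = X₄`, `[X₁,X₃] = −X₆`, `[X₁,X₀] = −X₄`,
`[X₂,X₃] = X₅`, `[X₁,X₅] = −X₇`, `[X₃,X₄] = X₇`, `[X₀,X₆] = X₇`, all other brackets of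
basis vectors being zero (up to skew-symmetry). -/
def gBr {M : Type*} [AddCommGroup M] (b : Fin 8 → M) (i j : Fin 8) : M :=
  match (i : ℕ), (j : ℕ) with
  | 1, 2 => b 4
  | 2, 1 => -b 4
  | 1, 3 => -b 6
  | 3, 1 => b 6
  | 1, 0 => -b 4
  | 0, 1 => b 4
  | 2, 3 => b 5
  | 3, 2 => -b 5
  | 1, 5 => -b 7
  | 5, 1 => b 7
  | 3, 4 => b 7
  | 4, 3 => -b 7
  | 0, 6 => b 7
  | 6, 0 => -b 7
  | _, _ => 0

/-- Structure constants of the 7-dimensional step-3 Carnot algebra `𝔤_μ`, with respect to an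
(ordered) basis `(X₁, …, X₇)` (indexed here by `0, …, 6`): `[X₁,X₂] = X₄`, `[X₁,X₃] = −X₆`,
`[X₂,X₃] = X₅`, `[X₁,X₅] = −X₇`, `[X₂,X₆] = μX₇`, `[X₃,X₄] = (1−μ)X₇`, all other brackets
of basis vectors being zero (up to skew-symmetry). -/
def gmuBr {M : Type*} [AddCommGroup M] [Module ℝ M] (μ : ℝ) (c : Fin 7 → M)
    (i j : Fin 7) : M :=
  match (i : ℕ), (j : ℕ) with
  | 0, 1 => c 3
  | 1, 0 => -c 3
  | 0, 2 => -c 5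
  | 2, 0 => c 5
  | 1, 2 => c 4
  | 2, 1 => -c 4
  | 0, 4 => -c 6
  | 4, 0 => c 6
  | 1, 5 => μ • c 6
  | 5, 1 => -(μ • c 6)
  | 2, 3 => (1 - μ) • c 6
  | 3, 2 => -((1 - μ) • c 6)
  | _, _ => 0

/-- A Carnot subalgebra of a Lie algebra: a Lie subalgebra generated by a subspace `W`
(of the first stratum, in applications) which is itself stratified with first stratum `W`. -/
def IsCarnotSubalgebraWithFirstStratum {L : Type*} [LieRing L] [LieAlgebra ℝ L]
    (h : LieSubalgebra ℝ L) (W : Submodule ℝ L) : Prop :=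
  h = LieSubalgebra.lieSpan ℝ L (W : Set L) ∧
    ∃ (s : ℕ) (V : ℕ → Submodule ℝ h),
      IsStratification (↥h) s V ∧ ∀ x : h, x ∈ V 0 ↔ (x : L) ∈ W

namespace Carnot

/-- Multiset-type rigidity: diagonal matrices that are conjugate up to scale. -/
lemma perm_case {l m k : ℝ} (hl : 2 < l) (hm : 2 < m) (σ : Equiv.Perm (Fin 3))
    (h : ∀ i, (![-1, m, 1 - m] : Fin 3 → ℝ) i = k * (![-1, l, 1 - l] : Fin 3 → ℝ) (σ i)) :
    l = m := by
  have h0 := h 0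
  have h1 := h 1
  have h2 := h 2
  have n01 : σ 0 ≠ σ 1 := fun e => by simpa using σ.injective e
  have n02 : σ 0 ≠ σ 2 := fun e => by simpa using σ.injective e
  have n12 : σ 1 ≠ σ 2 := fun e => by simpa using σ.injective e
  generalize σ 0 = p at *
  generalize σ 1 = q at *
  generalize σ 2 = r at *
  fin_cases p <;> fin_cases q <;> fin_cases r <;> simp at n01 n02 n12 h0 h1 h2
  · subst h0; linarith
  · subst h0; linarith
  · have : k = -m := by linarith
    subst this; nlinarith
  · have : k = m - 1 := by linarith
    subst this; nlinarith
  · have : k = -m := by linarith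
    subst this; nlinarith
  · have : k = m - 1 := by linarith
    subst this; nlinarith

lemma rigid {l m c : ℝ} (hl : 2 < l) (hm : 2 < m) (hc : c ≠ 0)
    (A : Matrix (Fin 3) (Fin 3) ℝ)
    (h : A * Matrix.diagonal ![-1, m, 1 - m] * A.adjugate
      = c • Matrix.diagonal ![-1, l, 1 - l]) : l = m := by
  have hdet : A.det ≠ 0 := by
    intro h0
    have := congrArg Matrix.det h
    rw [Matrix.det_mul, Matrix.det_mul, h0, Matrix.det_smul, Matrix.det_diagonal] at this
    simp [Fin.prod_univ_three] at this
    rcases this with h | h | h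
    · exact hc h
    · linarith
    · linarith
  have h2 : A.det • (A * Matrix.diagonal ![-1, m, 1 - m])
      = (c • Matrix.diagonal ![-1, l, 1 - l]) * A := by
    rw [← h, Matrix.mul_assoc, Matrix.adjugate_mul, Matrix.mul_smul, Matrix.mul_one]
  have h3 : ∃ σ : Equiv.Perm (Fin 3), ∀ i, A (σ i) i ≠ 0 := by
    by_contra hn
    push Not at hn
    apply hdet
    rw [Matrix.det_apply]
    refine Finset.sum_eq_zero fun σ _ => ?_
    obtain ⟨i, hi⟩ := hn σ
    have : ∏ j, A (σ j) j = 0 := Finset.prod_eq_zero (Finset.mem_univ i) hi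
    rw [this, smul_zero]
  obtain ⟨σ, hσ⟩ := h3
  refine perm_case hl hm (k := c / A.det) σ fun i => ?_
  have h4 := congrFun (congrFun h2 (σ i)) i
  rw [Matrix.smul_apply, Matrix.mul_diagonal, Matrix.smul_mul, Matrix.smul_apply,
    Matrix.diagonal_mul, smul_eq_mul, smul_eq_mul] at h4
  have h5 := hσ i
  field_simp
  apply mul_left_cancel₀ h5
  linarith

section
variable {L : Type*} [LieRing L] [LieAlgebra ℝ L] (b : Basis (Fin 8) ℝ L)

/-- Vector with given coordinates. -/
noncomputable def mk (v : Fin 8 → ℝ) : L := b.equivFun.symm v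

/-- Coordinates. -/
noncomputable def co (x : L) : Fin 8 → ℝ := b.equivFun x

@[simp] lemma co_mk (v : Fin 8 → ℝ) : co b (mk b v) = v := by simp only [co, mk, LinearEquiv.apply_symm_apply]
@[simp] lemma co_add (x y : L) : co b (x + y) = co b x + co b y := by simp only [co, map_add]
@[simp] lemma co_neg (x : L) : co b (-x) = - co b x := by simp only [co, map_neg]
@[simp] lemma co_smul (r : ℝ) (x : L) : co b (r • x) = r • co b x := by simp only [co, map_smul]
@[simp] lemma co_zero : co b 0 = 0 := by simp only [co, map_zero]
lemma co_basis (i : Fin 8) : co b (b i) = Pi.single i 1 := by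
  ext j; simp [co, Finsupp.single_apply, Pi.single_apply, eq_comm]

lemma co_inj {x y : L} (h : co b x = co b y) : x = y := b.equivFun.injective h

/-- Bracket in coordinates. -/
def br (x y : Fin 8 → ℝ) : Fin 8 → ℝ :=
  ![0, 0, 0, 0, x 1 * y 2 - x 2 * y 1 - (x 1 * y 0 - x 0 * y 1), x 2 * y 3 - x 3 * y 2,
    -(x 1 * y 3 - x 3 * y 1),
    -(x 1 * y 5 - x 5 * y 1) + (x 3 * y 4 - x 4 * y 3) + (x 0 * y 6 - x 6 * y 0)]

/-- The bracket in coordinates is given by `br`. -/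
def Good : Prop := ∀ x y : L, co b ⁅x, y⁆ = br (co b x) (co b y)

lemma co_br (hb : ∀ i j : Fin 8, ⁅b i, b j⁆ = gBr (fun k => b k) i j) : Good b := by
  intro x y
  have hx : x = ∑ i, co b x i • b i := (b.sum_equivFun x).symm
  have hy : y = ∑ i, co b y i • b i := (b.sum_equivFun y).symm
  generalize co b x = u at *
  generalize co b y = v at *
  rw [hx, hy]
  simp only [Fin.sum_univ_eight, add_lie, lie_add, smul_lie, lie_smul, hb, gBr]
  simp only [Fin.isValue, Fin.val_zero, Fin.val_one, Fin.coe_ofNat_eq_mod, Nat.reduceMod,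
    smul_zero, add_zero, zero_add, co_add, co_smul, co_neg, co_basis, smul_neg]
  ext k
  fin_cases k <;> simp [br, Pi.single_apply] <;> ring

/-- The hyperplane subalgebra `x₀ = l x₂`. -/
noncomputable def H (hg : Good b) (l : ℝ) : LieSubalgebra ℝ L where
  carrier := {x | co b x 0 = l * co b x 2}
  add_mem' := by
    intro x y hx hy
    simp only [Set.mem_ofPred_eq, co_add, Pi.add_apply] at *
    rw [hx, hy]; ring
  zero_mem' := by simp
  smul_mem' := by
    intro r x hx
    simp only [Set.mem_ofPred_eq, co_smul, Pi.smul_apply, smul_eq_mul] at *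
    rw [hx]; ring
  lie_mem' := by
    intro x y hx hy
    simp only [Set.mem_ofPred_eq] at *
    rw [hg]
    simp [br]

lemma mem_H (hg : Good b) (l : ℝ) (x : L) : x ∈ H b hg l ↔ co b x 0 = l * co b x 2 := Iff.rfl

lemma finrank_H (hg : Good b) (l : ℝ) : Module.finrank ℝ (H b hg l) = 7 := by
  let φ : L →ₗ[ℝ] ℝ := b.coord 0 - l • b.coord 2
  have hφ : ∀ x, φ x = co b x 0 - l * co b x 2 := fun x => by simp [φ, co]
  have hk : (H b hg l).toSubmodule = LinearMap.ker φ := by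
    ext x
    rw [LinearMap.mem_ker, hφ, LieSubalgebra.mem_toSubmodule, mem_H, sub_eq_zero]
  have hr : LinearMap.range φ = ⊤ := by
    rw [LinearMap.range_eq_top]
    intro r
    refine ⟨mk b ![r, 0, 0, 0, 0, 0, 0, 0], ?_⟩
    rw [hφ]; simp
  have : FiniteDimensional ℝ L := b.finiteDimensional_of_finite
  have h1 := φ.finrank_range_add_finrank_ker
  rw [hr, finrank_top, Module.finrank_self, Module.finrank_eq_card_basis b, ← hk,
    Fintype.card_fin] at h1
  have h2 : Module.finrank ℝ (H b hg l).toSubmodule = 7 := by omega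
  exact h2

/-- Degrees of the basis vectors. -/
def dg : Fin 8 → ℕ := ![0, 0, 0, 0, 1, 1, 1, 2]

/-- Graded pieces. -/
noncomputable def gr (i : ℕ) : Submodule ℝ L where
  carrier := {x | ∀ j, dg j ≠ i → co b x j = 0}
  add_mem' := by
    intro x y hx hy j hj
    simp [hx j hj, hy j hj]
  zero_mem' := by simp
  smul_mem' := by
    intro r x hx j hj
    simp [hx j hj]

lemma mem_gr (i : ℕ) (x : L) : x ∈ gr b i ↔ ∀ j, dg j ≠ i → co b x j = 0 := Iff.rfl

/-- Complementary pieces. -/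
noncomputable def gc (i : ℕ) : Submodule ℝ L where
  carrier := {x | ∀ j, dg j = i → co b x j = 0}
  add_mem' := by
    intro x y hx hy j hj
    simp [hx j hj, hy j hj]
  zero_mem' := by simp
  smul_mem' := by
    intro r x hx j hj
    simp [hx j hj]

lemma mem_gc (i : ℕ) (x : L) : x ∈ gc b i ↔ ∀ j, dg j = i → co b x j = 0 := Iff.rfl

/-- The strata of `H`. -/
noncomputable def V (hg : Good b) (l : ℝ) (i : ℕ) : Submodule ℝ (H b hg l) :=
  (gr b i).comap (H b hg l).toSubmodule.subtype

lemma mem_V (hg : Good b) (l : ℝ) (i : ℕ) (x : H b hg l) :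
    x ∈ V b hg l i ↔ ∀ j, dg j ≠ i → co b (x : L) j = 0 := Iff.rfl

lemma V_bot (hg : Good b) (l : ℝ) (i : ℕ) (hi : 3 ≤ i) : V b hg l i = ⊥ := by
  rw [eq_bot_iff]
  intro x hx
  rw [mem_V] at hx
  rw [Submodule.mem_bot]
  apply Subtype.ext
  apply co_inj b
  ext j
  rw [hx j (by fin_cases j <;> simp [dg] <;> omega)]
  simp

lemma V_br_le (hg : Good b) (l : ℝ) (i : ℕ) :
    bracketSpan (V b hg l 0) (V b hg l i) ≤ V b hg l (i + 1) := by
  rw [bracketSpan, Submodule.span_le]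
  rintro z ⟨x, hx, y, hy, rfl⟩
  rw [mem_V] at hx hy
  rw [SetLike.mem_coe, mem_V]
  rw [LieSubalgebra.coe_bracket, hg]
  have h4 := hx 4 (by simp [dg])
  have h5 := hx 5 (by simp [dg])
  have h6 := hx 6 (by simp [dg])
  rcases i with _ | _ | i
  · have g4 := hy 4 (by simp [dg])
    have g5 := hy 5 (by simp [dg])
    have g6 := hy 6 (by simp [dg])
    intro j hj
    fin_cases j <;> simp [dg] at hj <;> simp [br, *]
  · have g0 := hy 0 (by simp [dg])
    have g1 := hy 1 (by simp [dg])
    have g2 := hy 2 (by simp [dg])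
    have g3 := hy 3 (by simp [dg])
    intro j hj
    fin_cases j <;> simp [dg] at hj <;> simp [br, *]
  · have g0 := hy 0 (by simp [dg])
    have g1 := hy 1 (by simp [dg])
    have g2 := hy 2 (by simp [dg])
    have g3 := hy 3 (by simp [dg])
    have g4 := hy 4 (by simp [dg])
    have g5 := hy 5 (by simp [dg])
    have g6 := hy 6 (by simp [dg])
    intro j hj
    fin_cases j <;> simp [br, *]

/-- Elements of `H` from coordinates. -/
noncomputable def mkH (hg : Good b) (l : ℝ) (x1 x2 x3 x4 x5 x6 x7 : ℝ) : H b hg l :=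
  ⟨mk b ![l * x2, x1, x2, x3, x4, x5, x6, x7], by rw [mem_H, co_mk]; simp⟩

lemma co_mkH (hg : Good b) (l : ℝ) (x1 x2 x3 x4 x5 x6 x7 : ℝ) :
    co b (mkH b hg l x1 x2 x3 x4 x5 x6 x7 : L) = ![l * x2, x1, x2, x3, x4, x5, x6, x7] := by
  simp [mkH]

lemma mkH_V0 (hg : Good b) (l : ℝ) (x1 x2 x3 : ℝ) :
    mkH b hg l x1 x2 x3 0 0 0 0 ∈ V b hg l 0 := by
  rw [mem_V, co_mkH]
  intro j hj
  fin_cases j <;> simp [dg] at hj <;> simp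

lemma mkH_V1 (hg : Good b) (l : ℝ) (x1 x2 x3 : ℝ) :
    mkH b hg l 0 0 0 x1 x2 x3 0 ∈ V b hg l 1 := by
  rw [mem_V, co_mkH]
  intro j hj
  fin_cases j <;> simp [dg] at hj <;> simp

lemma mkH_V2 (hg : Good b) (l : ℝ) (x : ℝ) :
    mkH b hg l 0 0 0 0 0 0 x ∈ V b hg l 2 := by
  rw [mem_V, co_mkH]
  intro j hj
  fin_cases j <;> simp [dg] at hj <;> simp

lemma H_ext (hg : Good b) (l : ℝ) {x y : H b hg l} (h : co b (x : L) = co b (y : L)) : x = y :=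
  Subtype.ext (co_inj b h)

lemma H_add (hg : Good b) (l : ℝ) (x y : H b hg l) : ((x + y : H b hg l) : L) = x + y := rfl

lemma H_smul (hg : Good b) (l r : ℝ) (x : H b hg l) : ((r • x : H b hg l) : L) = r • (x : L) := rfl

lemma decomp (hg : Good b) (l : ℝ) (x : H b hg l) :
    x = mkH b hg l (co b (x : L) 1) (co b (x : L) 2) (co b (x : L) 3) 0 0 0 0
      + mkH b hg l 0 0 0 (co b (x : L) 4) (co b (x : L) 5) (co b (x : L) 6) 0
      + mkH b hg l 0 0 0 0 0 0 (co b (x : L) 7) := by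
  apply H_ext
  have := (mem_H b hg l x).1 x.2
  rw [H_add, H_add, co_add, co_add, co_mkH, co_mkH, co_mkH]
  ext j
  fin_cases j <;> simp [this]

lemma decomp1 (hg : Good b) (l : ℝ) (hl : l ≠ 1) (x4 x5 x6 : ℝ) :
    mkH b hg l 0 0 0 x4 x5 x6 0 =
      ⁅mkH b hg l (x4 / (1 - l)) 0 0 0 0 0 0, mkH b hg l 0 1 0 0 0 0 0⁆
      + ⁅mkH b hg l 0 x5 0 0 0 0 0, mkH b hg l 0 0 1 0 0 0 0⁆
      + ⁅mkH b hg l (-x6) 0 0 0 0 0 0, mkH b hg l 0 0 1 0 0 0 0⁆ := by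
  have : 1 - l ≠ 0 := sub_ne_zero.2 hl.symm
  apply H_ext
  rw [H_add, H_add, co_add, co_add, LieSubalgebra.coe_bracket,
    LieSubalgebra.coe_bracket, LieSubalgebra.coe_bracket, hg, hg, hg]
  simp only [co_mkH]
  ext j
  fin_cases j <;> simp [br]
  field_simp

lemma decomp2 (hg : Good b) (l : ℝ) (x : ℝ) :
    mkH b hg l 0 0 0 0 0 0 x =
      ⁅mkH b hg l (-x) 0 0 0 0 0 0, mkH b hg l 0 0 0 0 1 0 0⁆ := by
  apply H_ext
  rw [LieSubalgebra.coe_bracket, hg]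
  simp only [co_mkH]
  ext j
  fin_cases j <;> simp [br]

lemma V_step (hg : Good b) (l : ℝ) (hl : l ≠ 1) (i : ℕ) :
    V b hg l (i + 1) = bracketSpan (V b hg l 0) (V b hg l i) := by
  refine le_antisymm ?_ (V_br_le b hg l i)
  have key : ∀ {x y : H b hg l}, x ∈ V b hg l 0 → y ∈ V b hg l i →
      ⁅x, y⁆ ∈ bracketSpan (V b hg l 0) (V b hg l i) :=
    fun hx hy => Submodule.subset_span ⟨_, hx, _, hy, rfl⟩
  rcases i with _ | _ | i
  · intro x hx
    rw [mem_V] at hx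
    have h1 := hx 1 (by simp [dg])
    have h2 := hx 2 (by simp [dg])
    have h3 := hx 3 (by simp [dg])
    have h7 := hx 7 (by simp [dg])
    have e : x = mkH b hg l 0 0 0 (co b (x : L) 4) (co b (x : L) 5) (co b (x : L) 6) 0 := by
      apply H_ext
      have h0 := (mem_H b hg l x).1 x.2
      rw [co_mkH]
      ext j
      fin_cases j <;> simp [h0, h1, h2, h3, h7]
    rw [e, decomp1 b hg l hl]
    exact add_mem (add_mem (key (mkH_V0 b hg l _ _ _) (mkH_V0 b hg l _ _ _)) (key (mkH_V0 b hg l _ _ _) (mkH_V0 b hg l _ _ _)))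
      (key (mkH_V0 b hg l _ _ _) (mkH_V0 b hg l _ _ _))
  · intro x hx
    rw [mem_V] at hx
    have e : x = mkH b hg l 0 0 0 0 0 0 (co b (x : L) 7) := by
      apply H_ext
      rw [co_mkH]
      ext j
      have := hx j
      fin_cases j <;> simp [dg] at this <;> simp [this]
    rw [e, decomp2 b hg l]
    exact key (mkH_V0 b hg l _ _ _) (mkH_V1 b hg l _ _ _)
  · rw [V_bot b hg l _ (by omega)]
    exact bot_le

lemma strat (hg : Good b) (l : ℝ) (hl : l ≠ 1) :
    IsStratification (H b hg l) 3 (V b hg l) where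
  indep := by
    intro i
    rw [Submodule.disjoint_def]
    intro x hx hxs
    have hle : (⨆ j, ⨆ (_ : j ≠ i), V b hg l j) ≤
        (gc b i).comap (H b hg l).toSubmodule.subtype := by
      refine iSup₂_le fun j hj y hy => ?_
      intro k hk
      exact hy k (by rw [hk]; exact hj.symm)
    have h2 := hle hxs
    apply H_ext
    ext k
    have : co b (x : L) k = 0 := by
      by_cases hk : dg k = i
      · exact h2 k hk
      · exact hx k hk
    rw [this]
    simp
  supEq := by
    rw [eq_top_iff]
    intro x _
    rw [decomp b hg l x]
    exact add_mem (add_mem (Submodule.mem_iSup_of_mem 0 (mkH_V0 b hg l _ _ _))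
      (Submodule.mem_iSup_of_mem 1 (mkH_V1 b hg l _ _ _))) (Submodule.mem_iSup_of_mem 2 (mkH_V2 b hg l _))
  last_ne_bot := by
    intro h
    have h1 := mkH_V2 b hg l 1
    have hV : V b hg l 2 = ⊥ := h
    rw [hV, Submodule.mem_bot] at h1
    have h2 := co_mkH b hg l 0 0 0 0 0 0 1
    rw [h1] at h2
    have h3 := congrFun h2 7
    simp at h3
  bot_of_ge := V_bot b hg l
  step := V_step b hg l hl

/-- First stratum inside `L`. -/
noncomputable def W (hg : Good b) (l : ℝ) : Submodule ℝ L := gr b 0 ⊓ (H b hg l).toSubmodule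

lemma W_le (hg : Good b) (l : ℝ) : W b hg l ≤ Submodule.span ℝ {b 0, b 1, b 2, b 3} := by
  intro x hx
  have hx1 : x ∈ gr b 0 := hx.1
  rw [mem_gr] at hx1
  have h4 := hx1 4 (by simp [dg])
  have h5 := hx1 5 (by simp [dg])
  have h6 := hx1 6 (by simp [dg])
  have h7 := hx1 7 (by simp [dg])
  have e : x = ∑ i, co b x i • b i := (b.sum_equivFun x).symm
  rw [e, Fin.sum_univ_eight, h4, h5, h6, h7]
  simp only [zero_smul, add_zero]
  have m : ∀ i : Fin 8, b i ∈ ({b 0, b 1, b 2, b 3} : Set L) → co b x i • b i ∈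
      Submodule.span ℝ {b 0, b 1, b 2, b 3} :=
    fun i hi => Submodule.smul_mem _ _ (Submodule.subset_span hi)
  exact add_mem (add_mem (add_mem (m 0 (by simp)) (m 1 (by simp))) (m 2 (by simp)))
    (m 3 (by simp))

lemma carnot (hg : Good b) (l : ℝ) (hl : l ≠ 1) :
    IsCarnotSubalgebraWithFirstStratum (H b hg l) (W b hg l) := by
  refine ⟨le_antisymm ?_ ?_, 3, V b hg l, strat b hg l hl, fun x => ?_⟩
  · intro x hx
    have k0 : ∀ x1 x2 x3, (mkH b hg l x1 x2 x3 0 0 0 0 : L) ∈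
        LieSubalgebra.lieSpan ℝ L (W b hg l : Set L) := fun x1 x2 x3 =>
      LieSubalgebra.subset_lieSpan ⟨mkH_V0 b hg l x1 x2 x3, (mkH b hg l x1 x2 x3 0 0 0 0).2⟩
    have k1 : ∀ x1 x2 x3, (mkH b hg l 0 0 0 x1 x2 x3 0 : L) ∈
        LieSubalgebra.lieSpan ℝ L (W b hg l : Set L) := fun x1 x2 x3 => by
      rw [decomp1 b hg l hl]
      simp only [H_add, LieSubalgebra.coe_bracket]
      exact add_mem (add_mem (LieSubalgebra.lie_mem _ (k0 _ _ _) (k0 _ _ _))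
        (LieSubalgebra.lie_mem _ (k0 _ _ _) (k0 _ _ _))) (LieSubalgebra.lie_mem _ (k0 _ _ _) (k0 _ _ _))
    have k2 : ∀ x, (mkH b hg l 0 0 0 0 0 0 x : L) ∈
        LieSubalgebra.lieSpan ℝ L (W b hg l : Set L) := fun x => by
      rw [decomp2 b hg l]
      simp only [LieSubalgebra.coe_bracket]
      exact LieSubalgebra.lie_mem _ (k0 _ _ _) (k1 _ _ _)
    have e := congrArg (Subtype.val) (decomp b hg l ⟨x, hx⟩)
    simp only [H_add] at e
    rw [e]
    exact add_mem (add_mem (k0 _ _ _) (k1 _ _ _)) (k2 _)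
  · rw [LieSubalgebra.lieSpan_le]
    intro x hx
    exact hx.2
  · exact ⟨fun h => ⟨h, x.2⟩, fun h => h.1⟩

/-- The trilinear form of the iterated bracket. -/
def tri (l : ℝ) (x y z : Fin 8 → ℝ) : ℝ :=
  -x 1 * (y 2 * z 3 - y 3 * z 2) + l * x 2 * (y 3 * z 1 - y 1 * z 3)
    + (1 - l) * x 3 * (y 1 * z 2 - y 2 * z 1)

lemma co_tri (hg : Good b) (l : ℝ) (x y z : H b hg l) :
    ⁅x, ⁅y, z⁆⁆ = mkH b hg l 0 0 0 0 0 0 (tri l (co b (x : L)) (co b (y : L)) (co b (z : L))) := by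
  apply H_ext
  rw [LieSubalgebra.coe_bracket, LieSubalgebra.coe_bracket, hg, hg, co_mkH]
  have hx := (mem_H b hg l x).1 x.2
  have hy := (mem_H b hg l y).1 y.2
  have hz := (mem_H b hg l z).1 z.2
  ext j
  fin_cases j <;> simp [br, tri, hx, hy, hz]
  ring

lemma mkH7_smul (hg : Good b) (l t : ℝ) :
    mkH b hg l 0 0 0 0 0 0 t = t • mkH b hg l 0 0 0 0 0 0 1 := by
  apply H_ext
  rw [H_smul, co_smul, co_mkH, co_mkH]
  ext j
  fin_cases j <;> simp

lemma iso_eq (hg : Good b) {l m : ℝ} (hl : 2 < l) (hm : 2 < m)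
    (f : H b hg l ≃ₗ⁅ℝ⁆ H b hg m) : l = m := by
  let X : Fin 3 → H b hg l := ![mkH b hg l 1 0 0 0 0 0 0, mkH b hg l 0 1 0 0 0 0 0,
    mkH b hg l 0 0 1 0 0 0 0]
  let c : ℝ := co b (f (mkH b hg l 0 0 0 0 0 0 1) : L) 7
  have key : ∀ x y z : H b hg l,
      mkH b hg m 0 0 0 0 0 0 (tri m (co b (f x : L)) (co b (f y : L)) (co b (f z : L)))
      = tri l (co b (x : L)) (co b (y : L)) (co b (z : L)) •
          f (mkH b hg l 0 0 0 0 0 0 1) := by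
    intro x y z
    have h := congrArg f (co_tri b hg l x y z)
    rw [LieEquiv.map_lie, LieEquiv.map_lie, co_tri, mkH7_smul b hg l, map_smul] at h
    exact h
  have key7 : ∀ x y z : H b hg l, tri m (co b (f x : L)) (co b (f y : L)) (co b (f z : L))
      = tri l (co b (x : L)) (co b (y : L)) (co b (z : L)) * c := by
    intro x y z
    have h := congrArg (fun w : H b hg m => co b (w : L) 7) (key x y z)
    simp only [co_mkH, H_smul, co_smul] at h
    simpa [c] using h
  have hc : c ≠ 0 := by
    intro h0
    have h1 := key (X 0) (X 1) (X 2)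
    rw [key7, h0, mul_zero, mkH7_smul, zero_smul] at h1
    have h2 : tri l (co b (X 0 : L)) (co b (X 1 : L)) (co b (X 2 : L)) = -1 := by
      simp [X, co_mkH, tri]
    rw [h2] at h1
    have h3 : f (mkH b hg l 0 0 0 0 0 0 1) = f 0 := by
      rw [map_zero]
      simpa using h1.symm
    have h4 := f.injective h3
    have h5 := congrArg (fun w : H b hg l => co b (w : L) 7) h4
    simp [co_mkH] at h5
  let A : Matrix (Fin 3) (Fin 3) ℝ := Matrix.of fun i j => co b (f (X i) : L) (![1, 2, 3] j)
  apply rigid hl hm hc A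
  have E : ∀ i j k : Fin 3, tri m (co b (f (X i) : L)) (co b (f (X j) : L)) (co b (f (X k) : L))
    = tri l (co b (X i : L)) (co b (X j : L)) (co b (X k : L)) * c := fun i j k => key7 _ _ _
  have X0 : co b (X 0 : L) = ![0, 1, 0, 0, 0, 0, 0, 0] := by simp [X, co_mkH]
  have X1 : co b (X 1 : L) = ![l, 0, 1, 0, 0, 0, 0, 0] := by simp [X, co_mkH]
  have X2 : co b (X 2 : L) = ![0, 0, 0, 1, 0, 0, 0, 0] := by simp [X, co_mkH]
  ext i j
  fin_cases j
  · have h := E i 1 2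
    fin_cases i <;> simp [X0, X1, X2, tri] at h <;>
      simp [A, Matrix.mul_apply, Fin.sum_univ_three, Matrix.adjugate_fin_three,
        Matrix.diagonal_apply] <;> linarith
  · have h := E i 2 0
    fin_cases i <;> simp [X0, X1, X2, tri] at h <;>
      simp [A, Matrix.mul_apply, Fin.sum_univ_three, Matrix.adjugate_fin_three,
        Matrix.diagonal_apply] <;> linarith
  · have h := E i 0 1
    fin_cases i <;> simp [X0, X1, X2, tri] at h <;>
      simp [A, Matrix.mul_apply, Fin.sum_univ_three, Matrix.adjugate_fin_three,
        Matrix.diagonal_apply] <;> linarith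

lemma H_inj (hg : Good b) : Function.Injective (H b hg) := by
  intro l m h
  have h1 : (mkH b hg l 0 1 0 0 0 0 0 : L) ∈ H b hg m := h ▸ (mkH b hg l 0 1 0 0 0 0 0).2
  rw [mem_H, co_mkH] at h1
  simpa using h1

end
end Carnot

theorem stmt1
    {L : Type*} [LieRing L] [LieAlgebra ℝ L]
    (b : Basis (Fin 8) ℝ L)
    (hb : ∀ i j : Fin 8, ⁅b i, b j⁆ = gBr (fun k => b k) i j) :
    -- there is an uncountable family of Carnot subalgebras of dimension 7 of 𝔤 ...
    ∃ F : Set (LieSubalgebra ℝ L),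
      ¬F.Countable ∧
      (∀ h ∈ F, Module.finrank ℝ h = 7 ∧
        ∃ W : Submodule ℝ L,
          W ≤ Submodule.span ℝ {b 0, b 1, b 2, b 3} ∧
          IsCarnotSubalgebraWithFirstStratum h W) ∧
      -- ... that are pairwise non-isomorphic as Lie algebras
      (∀ h₁ ∈ F, ∀ h₂ ∈ F, h₁ ≠ h₂ → IsEmpty (↥h₁ ≃ₗ⁅ℝ⁆ ↥h₂)) := by
  have hg := Carnot.co_br b hb
  refine ⟨Set.image (Carnot.H b hg) (Set.Ioi 2), ?_, ?_, ?_⟩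
  · intro h
    have h2 := Set.countable_of_injective_of_countable_image
      (Carnot.H_inj b hg).injOn h
    have h3 := Cardinal.mk_Ioi_real 2
    have h4 := Cardinal.le_aleph0_iff_set_countable.2 h2
    rw [h3] at h4
    exact absurd h4 (not_le.2 Cardinal.aleph0_lt_continuum)
  · rintro _ ⟨l, hl, rfl⟩
    have hl2 : (2 : ℝ) < l := hl
    exact ⟨Carnot.finrank_H b hg l, Carnot.W b hg l, Carnot.W_le b hg l,
      Carnot.carnot b hg l (by linarith)⟩
  · rintro _ ⟨l, hl, rfl⟩ _ ⟨m, hm, rfl⟩ hne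
    exact ⟨fun f => hne (by rw [Carnot.iso_eq b hg hl hm f])⟩
end

section
/- There exist a Carnot group G and a C^∞ non-characteristic hypersurface S ⊆ G such that the family of tangent groups {T_p^I S}_{p∈S} contains uncountably many pairwise non-isomorphic Carnot groups. (Such an example exists in the Carnot group of topological dimension 8 whose Lie algebra is the algebra 𝔤 defined below.) -/
open Metric MeasureTheory
open scoped ENNReal NNReal Topology

/-- A Carnot group structure on a group `G` equipped with a distance, presented in
exponential coordinates of the first kind: `φ : G ≃ ℝⁿ` identifies `G` with `ℝⁿ`
(homeomorphically), each coordinate has a weight `w i ≥ 1` (the index of the stratum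
of the corresponding basis vector of the Lie algebra), the identity is at the origin,
inversion is `x ↦ -x`, the multiplication is smooth in coordinates, the dilations
`δ_λ(x)ᵢ = λ^{w i} xᵢ` are group homomorphisms, the horizontal points (those whose
coordinates of weight `≠ 1` vanish, i.e. `exp V₁`) generate `G` (this encodes that
the Lie algebra is stratified, i.e. generated by its first stratum), and the distance
is left-invariant and homogeneous with respect to the dilations. -/
structure CarnotStructure (n : ℕ) (G : Type*) [Group G] [MetricSpace G] where
  φ : G ≃ (Fin n → ℝ)
  w : Fin n → ℕ
  w_pos : ∀ i, 1 ≤ w i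
  continuous_coords : Continuous φ
  continuous_coords_symm : Continuous φ.symm
  coords_one : φ 1 = 0
  coords_inv : ∀ x : G, φ x⁻¹ = -φ x
  smooth_mul : ContDiff ℝ (⊤ : ℕ∞) fun p : (Fin n → ℝ) × (Fin n → ℝ) => φ (φ.symm p.1 * φ.symm p.2)
  dil_mul : ∀ (lam : ℝ) (x y : G),
    φ.symm (fun i => lam ^ w i * φ (x * y) i) =
      φ.symm (fun i => lam ^ w i * φ x i) * φ.symm (fun i => lam ^ w i * φ y i)
  horizontal_gen : Subgroup.closure {x : G | ∀ i, w i ≠ 1 → φ x i = 0} = ⊤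
  dist_left_invariant : ∀ z x y : G, dist (z * x) (z * y) = dist x y
  dist_homogeneous : ∀ (lam : ℝ), 0 ≤ lam → ∀ x y : G,
    dist (φ.symm fun i => lam ^ w i * φ x i) (φ.symm fun i => lam ^ w i * φ y i) =
      lam * dist x y

namespace CarnotStructure

variable {n : ℕ} {G : Type*} [Group G] [MetricSpace G]

/-- The homogeneous dimension `Q = Σᵢ i · dim Vᵢ` of a Carnot group. -/
def Q (C : CarnotStructure n G) : ℕ := ∑ i, C.w i

/-- The indices of the horizontal (first stratum) coordinates. -/
def horiz (C : CarnotStructure n G) : Finset (Fin n) :=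
  Finset.univ.filter fun i => C.w i = 1

/-- The derivative at `x` of a function `f : G → ℝ` along the left-invariant vector
field `Xᵢ` extending the `i`-th coordinate vector (`X_i f(x)`). -/
noncomputable def XDeriv (C : CarnotStructure n G) (i : Fin n) (f : G → ℝ) (x : G) : ℝ :=
  deriv (fun t : ℝ => f (x * C.φ.symm (t • (Pi.single i 1 : Fin n → ℝ)))) 0

/-- `S` is a `C¹_H`-hypersurface: locally the zero set of a function with continuous
and nonvanishing horizontal gradient. -/
def IsC1HHypersurface (C : CarnotStructure n G) (S : Set G) : Prop :=
  ∀ p ∈ S, ∃ U : Set G, IsOpen U ∧ p ∈ U ∧ ∃ f : G → ℝ,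
    S ∩ U = {x : G | f x = 0} ∩ U ∧
    ∃ Xf : Fin n → G → ℝ,
      (∀ i ∈ C.horiz, ∀ x ∈ U,
        HasDerivAt (fun t : ℝ => f (x * C.φ.symm (t • (Pi.single i 1 : Fin n → ℝ)))) (Xf i x) 0) ∧
      (∀ i ∈ C.horiz, ContinuousOn (Xf i) U) ∧
      (∀ x ∈ U, ∃ i ∈ C.horiz, Xf i x ≠ 0)

/-- `f` is a smooth local defining function for the hypersurface `S` at `p`, on the open
neighbourhood `U`, with nonvanishing (Euclidean) gradient. -/
def IsDefiningAt (C : CarnotStructure n G) (S : Set G) (p : G) (U : Set G)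
    (f : (Fin n → ℝ) → ℝ) : Prop :=
  IsOpen U ∧ p ∈ U ∧ ContDiff ℝ (⊤ : ℕ∞) f ∧
    S ∩ U = {x : G | f (C.φ x) = 0} ∩ U ∧
    ∀ x ∈ U, fderiv ℝ f (C.φ x) ≠ 0

/-- `S` is a `C^∞`-hypersurface of `G` (in exponential coordinates). -/
def IsSmoothHypersurface (C : CarnotStructure n G) (S : Set G) : Prop :=
  ∀ p ∈ S, ∃ U f, C.IsDefiningAt S p U f

/-- `f` is a smooth local defining function for `S` at `p` which moreover witnesses that
`S` has no characteristic points in `U`: at every point of `S ∩ U` some horizontal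
derivative `X_i f` is nonzero (equivalently, the horizontal space is not contained in the
Euclidean tangent space of `S`). -/
def IsNonCharDefiningAt (C : CarnotStructure n G) (S : Set G) (p : G) (U : Set G)
    (f : (Fin n → ℝ) → ℝ) : Prop :=
  C.IsDefiningAt S p U f ∧
    ∀ x ∈ S ∩ U, ∃ i ∈ C.horiz, C.XDeriv i (fun g => f (C.φ g)) x ≠ 0

/-- `S` is a `C^∞` non-characteristic hypersurface of `G`. -/
def IsSmoothNonCharHypersurface (C : CarnotStructure n G) (S : Set G) : Prop :=
  ∀ p ∈ S, ∃ U f, C.IsNonCharDefiningAt S p U f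

/-- The tangent group `T_p^I S = {v : Σᵢ vᵢ Xᵢf(p) = 0}` of the hypersurface `{f ∘ φ = 0}`
at `p`. -/
noncomputable def tangentSet (C : CarnotStructure n G) (f : (Fin n → ℝ) → ℝ) (p : G) :
    Set G :=
  {v : G | ∑ i ∈ C.horiz, C.φ v i * C.XDeriv i (fun g => f (C.φ g)) p = 0}

/-- `v` is the Lie bracket `⁅x, y⁆` of the Lie algebra of `G` read in exponential
coordinates: the group commutator of `δ_t(exp x)` and `δ_t(exp y)` is `t² ⁅x,y⁆ + o(t²)`. -/
def IsBracket (C : CarnotStructure n G) (x y v : Fin n → ℝ) : Prop :=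
  Filter.Tendsto
    (fun t : ℝ => (t ^ 2)⁻¹ •
      C.φ (C.φ.symm (t • x) * C.φ.symm (t • y) * (C.φ.symm (t • x))⁻¹ * (C.φ.symm (t • y))⁻¹))
    (𝓝[≠] (0 : ℝ)) (𝓝 v)

end CarnotStructure

/-- A witness for Statement 6 on a Carnot group `G`: a `C^∞` non-characteristic
hypersurface `S ⊆ G` whose family of tangent groups `{T_p^I S}_{p ∈ S}` contains
uncountably many pairwise non-isomorphic Carnot groups (non-isomorphic as topological
groups; by Pansu's theorem non-isomorphic Carnot groups are not even bi-Lipschitz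
equivalent). -/
structure Stmt6Witness (n : ℕ) (G : Type) [Group G] [MetricSpace G] where
  C : CarnotStructure n G
  S : Set G
  smooth_nonchar : C.IsSmoothNonCharHypersurface S
  /-- the tangent group map: `T p` is the tangent group of `S` at `p` (a subgroup of `G`),
  computed via any local defining function `f` of `S` at `p` as `{v : Σᵢ vᵢ Xᵢf(p) = 0}` -/
  T : G → Subgroup G
  T_eq : ∀ p ∈ S, ∀ U f, C.IsNonCharDefiningAt S p U f → (T p : Set G) = C.tangentSet f p
  /-- an uncountable set of points of `S` ... -/
  P : Set G
  P_sub : P ⊆ S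
  P_uncountable : ¬P.Countable
  /-- ... whose tangent groups are pairwise non-isomorphic -/
  pairwise_noniso : ∀ p ∈ P, ∀ q ∈ P, p ≠ q →
    ¬∃ e : ↥(T p) ≃* ↥(T q), Continuous e ∧ Continuous e.symm

namespace Ex6

/-- First component of the (unnormalised) bracket. -/
def om1 (x y : Fin 11 → ℝ) : ℝ :=
  (x 1 * y 2 - x 2 * y 1) + (x 3 * y 4 - x 4 * y 3) + (x 7 * y 8 - x 8 * y 7)

/-- Second component of the (unnormalised) bracket. -/
def om2 (x y : Fin 11 → ℝ) : ℝ :=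
  (x 0 * y 2 - x 2 * y 0) + (x 5 * y 6 - x 6 * y 5) + (x 7 * y 8 - x 8 * y 7)

/-- The bracket as a vector. -/
noncomputable def bb (x y : Fin 11 → ℝ) : Fin 11 → ℝ :=
  ![0, 0, 0, 0, 0, 0, 0, 0, 0, (1 / 3) * om1 x y, (1 / 3) * om2 x y]

/-- Weights. -/
def wt : Fin 11 → ℕ := ![1, 1, 1, 1, 1, 1, 1, 1, 1, 2, 2]

/-- The underlying type of the group. -/
@[ext] structure GG : Type where
  c : Fin 11 → ℝ

/-- Coordinates. -/
def coords : GG ≃ (Fin 11 → ℝ) := ⟨GG.c, GG.mk, fun _ => rfl, fun _ => rfl⟩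

noncomputable instance : Mul GG := ⟨fun x y => ⟨x.c + y.c + bb x.c y.c⟩⟩
instance : One GG := ⟨⟨0⟩⟩
instance : Inv GG := ⟨fun x => ⟨-x.c⟩⟩

theorem mul_c (x y : GG) : (x * y).c = x.c + y.c + bb x.c y.c := rfl
theorem one_c : (1 : GG).c = 0 := rfl
theorem inv_c (x : GG) : (x⁻¹).c = -x.c := rfl

theorem ext11 {x y : Fin 11 → ℝ} (h0 : x 0 = y 0) (h1 : x 1 = y 1) (h2 : x 2 = y 2)
    (h3 : x 3 = y 3) (h4 : x 4 = y 4) (h5 : x 5 = y 5) (h6 : x 6 = y 6) (h7 : x 7 = y 7)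
    (h8 : x 8 = y 8) (h9 : x 9 = y 9) (h10 : x 10 = y 10) : x = y := by
  funext i
  fin_cases i <;> assumption

theorem bb0 (x y : Fin 11 → ℝ) : bb x y 0 = 0 := rfl
theorem bb1 (x y : Fin 11 → ℝ) : bb x y 1 = 0 := rfl
theorem bb2 (x y : Fin 11 → ℝ) : bb x y 2 = 0 := rfl
theorem bb3 (x y : Fin 11 → ℝ) : bb x y 3 = 0 := rfl
theorem bb4 (x y : Fin 11 → ℝ) : bb x y 4 = 0 := rfl
theorem bb5 (x y : Fin 11 → ℝ) : bb x y 5 = 0 := rfl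
theorem bb6 (x y : Fin 11 → ℝ) : bb x y 6 = 0 := rfl
theorem bb7 (x y : Fin 11 → ℝ) : bb x y 7 = 0 := rfl
theorem bb8 (x y : Fin 11 → ℝ) : bb x y 8 = 0 := rfl
theorem bb9 (x y : Fin 11 → ℝ) : bb x y 9 = (1 / 3) * om1 x y := rfl
theorem bb10 (x y : Fin 11 → ℝ) : bb x y 10 = (1 / 3) * om2 x y := rfl

noncomputable instance : Group GG := Group.ofLeftAxioms
  (by
    intro x y z
    apply GG.ext
    simp only [mul_c]
    apply ext11 <;>
      simp only [Pi.add_apply, bb0, bb1, bb2, bb3, bb4, bb5, bb6, bb7, bb8, bb9, bb10,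
        om1, om2] <;> ring)
  (by
    intro x
    apply GG.ext
    simp only [mul_c, one_c]
    apply ext11 <;>
      simp [bb0, bb1, bb2, bb3, bb4, bb5, bb6, bb7, bb8, bb9, bb10, om1, om2])
  (by
    intro x
    apply GG.ext
    simp only [mul_c, one_c, inv_c]
    apply ext11 <;>
      simp only [Pi.add_apply, Pi.neg_apply, Pi.zero_apply, bb0, bb1, bb2, bb3, bb4, bb5, bb6,
        bb7, bb8, bb9, bb10, om1, om2] <;> ring)

/-- Auxiliary vector whose sup norm is the homogeneous norm. -/
noncomputable def psi (x : Fin 11 → ℝ) : Fin 11 → ℝ :=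
  ![x 0, x 1, x 2, x 3, x 4, x 5, x 6, x 7, x 8, √(|x 9|), √(|x 10|)]

/-- The homogeneous norm. -/
noncomputable def hn (x : Fin 11 → ℝ) : ℝ := ‖psi x‖

theorem hn_nonneg (x : Fin 11 → ℝ) : 0 ≤ hn x := norm_nonneg _

theorem hn_le_iff (x : Fin 11 → ℝ) {r : ℝ} (hr : 0 ≤ r) :
    hn x ≤ r ↔ ∀ i, |x i| ≤ r ^ wt i := by
  unfold hn
  rw [pi_norm_le_iff_of_nonneg hr]
  refine forall_congr' fun i => ?_
  rw [Real.norm_eq_abs]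
  have key : ∀ a : ℝ, |(√(|a|))| ≤ r ↔ |a| ≤ r ^ 2 := fun a => by
    rw [abs_of_nonneg (Real.sqrt_nonneg _), Real.sqrt_le_left hr]
  fin_cases i
  all_goals first
    | exact key _
    | (show |x _| ≤ r ↔ |x _| ≤ r ^ 1; rw [pow_one]; rfl)

theorem abs_le_hn (x : Fin 11 → ℝ) (i : Fin 11) : |x i| ≤ hn x ^ wt i :=
  (hn_le_iff x (hn_nonneg x)).1 le_rfl i

theorem hn_neg (x : Fin 11 → ℝ) : hn (-x) = hn x := by
  apply le_antisymm
  · rw [hn_le_iff _ (hn_nonneg _)]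
    intro i
    simpa using abs_le_hn x i
  · rw [hn_le_iff _ (hn_nonneg _)]
    intro i
    simpa using abs_le_hn (-x) i

theorem hn_zero : hn 0 = 0 := by
  apply le_antisymm _ (hn_nonneg _)
  rw [hn_le_iff _ le_rfl]
  intro i
  simp

theorem eq_zero_of_hn (x : Fin 11 → ℝ) (h : hn x = 0) : x = 0 := by
  funext i
  have := abs_le_hn x i
  rw [h, zero_pow (by fin_cases i <;> decide)] at this
  simpa using this

theorem det_bd {a b p q r s : ℝ} (hp : |p| ≤ a) (hq : |q| ≤ a) (hr : |r| ≤ b) (hs : |s| ≤ b) :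
    |p * s - q * r| ≤ 2 * (a * b) := by
  have ha : 0 ≤ a := (abs_nonneg _).trans hp
  calc |p * s - q * r| ≤ |p * s| + |q * r| := abs_sub _ _
    _ = |p| * |s| + |q| * |r| := by rw [abs_mul, abs_mul]
    _ ≤ a * b + a * b := by gcongr
    _ = _ := by ring

theorem om1_bd (x y : Fin 11 → ℝ) : |om1 x y| ≤ 6 * (hn x * hn y) := by
  have X : ∀ i, wt i = 1 → |x i| ≤ hn x := fun i h => by simpa [h] using abs_le_hn x i
  have Y : ∀ i, wt i = 1 → |y i| ≤ hn y := fun i h => by simpa [h] using abs_le_hn y i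
  have h1 := det_bd (X 1 rfl) (X 2 rfl) (Y 1 rfl) (Y 2 rfl)
  have h2 := det_bd (X 3 rfl) (X 4 rfl) (Y 3 rfl) (Y 4 rfl)
  have h3 := det_bd (X 7 rfl) (X 8 rfl) (Y 7 rfl) (Y 8 rfl)
  unfold om1
  have := abs_add_three (x 1 * y 2 - x 2 * y 1) (x 3 * y 4 - x 4 * y 3) (x 7 * y 8 - x 8 * y 7)
  linarith

theorem om2_bd (x y : Fin 11 → ℝ) : |om2 x y| ≤ 6 * (hn x * hn y) := by
  have X : ∀ i, wt i = 1 → |x i| ≤ hn x := fun i h => by simpa [h] using abs_le_hn x i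
  have Y : ∀ i, wt i = 1 → |y i| ≤ hn y := fun i h => by simpa [h] using abs_le_hn y i
  have h1 := det_bd (X 0 rfl) (X 2 rfl) (Y 0 rfl) (Y 2 rfl)
  have h2 := det_bd (X 5 rfl) (X 6 rfl) (Y 5 rfl) (Y 6 rfl)
  have h3 := det_bd (X 7 rfl) (X 8 rfl) (Y 7 rfl) (Y 8 rfl)
  unfold om2
  have := abs_add_three (x 0 * y 2 - x 2 * y 0) (x 5 * y 6 - x 6 * y 5) (x 7 * y 8 - x 8 * y 7)
  linarith

theorem hn_mul (x y : Fin 11 → ℝ) : hn (x + y + bb x y) ≤ hn x + hn y := by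
  rw [hn_le_iff _ (add_nonneg (hn_nonneg x) (hn_nonneg y))]
  have A : ∀ i, bb x y i = 0 → wt i = 1 →
      |(x + y + bb x y) i| ≤ (hn x + hn y) ^ wt i := by
    intro i h0 h1
    have hx := abs_le_hn x i
    have hy := abs_le_hn y i
    have := abs_add_le (x i) (y i)
    simp only [Pi.add_apply, h0, add_zero, h1, pow_one] at *
    linarith
  have B : ∀ i, wt i = 2 → |bb x y i| ≤ 2 * (hn x * hn y) →
      |(x + y + bb x y) i| ≤ (hn x + hn y) ^ wt i := by
    intro i h1 h0
    have hx := abs_le_hn x i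
    have hy := abs_le_hn y i
    have := abs_add_three (x i) (y i) (bb x y i)
    simp only [Pi.add_apply, h1] at *
    nlinarith
  have h9 : |bb x y 9| ≤ 2 * (hn x * hn y) := by
    rw [bb9, abs_mul, abs_of_pos (by norm_num)]
    linarith [om1_bd x y]
  have h10 : |bb x y 10| ≤ 2 * (hn x * hn y) := by
    rw [bb10, abs_mul, abs_of_pos (by norm_num)]
    linarith [om2_bd x y]
  intro i
  fin_cases i
  all_goals first
    | exact A _ rfl rfl
    | exact B 9 rfl h9
    | exact B 10 rfl h10

noncomputable instance : MetricSpace GG where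
  dist x y := hn (x⁻¹ * y).c
  dist_self x := by simp [one_c, hn_zero]
  dist_comm x y := by
    have : (y⁻¹ * x) = (x⁻¹ * y)⁻¹ := by group
    rw [this, inv_c, hn_neg]
  dist_triangle x y z := by
    have : x⁻¹ * z = (x⁻¹ * y) * (y⁻¹ * z) := by group
    rw [this, mul_c]
    exact hn_mul _ _
  eq_of_dist_eq_zero := by
    intro x y h
    have h2 := eq_zero_of_hn _ h
    have h3 : x⁻¹ * y = 1 := GG.ext h2
    exact (inv_mul_eq_one.1 h3)

theorem dist_def (x y : GG) : dist x y = hn (x⁻¹ * y).c := rfl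

theorem contDiff_mul : ContDiff ℝ (⊤ : ℕ∞)
    fun p : (Fin 11 → ℝ) × (Fin 11 → ℝ) => p.1 + p.2 + bb p.1 p.2 := by
  refine contDiff_pi.2 fun i => ?_
  fin_cases i <;>
    simp [bb0, bb1, bb2, bb3, bb4, bb5, bb6, bb7, bb8, bb9, bb10, om1, om2] <;> fun_prop

theorem continuous_hn : Continuous hn := by
  refine Continuous.norm (continuous_pi fun i => ?_)
  fin_cases i <;> simp [psi] <;> fun_prop

theorem continuous_symm : Continuous (coords.symm : (Fin 11 → ℝ) → GG) := by
  rw [continuous_iff_continuousAt]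
  intro x
  rw [ContinuousAt, tendsto_iff_dist_tendsto_zero]
  have h : Continuous fun y : Fin 11 → ℝ => hn (-y + x + bb (-y) x) :=
    continuous_hn.comp (contDiff_mul.continuous.comp (by fun_prop :
      Continuous fun y : Fin 11 → ℝ => ((-y, x) : (Fin 11 → ℝ) × (Fin 11 → ℝ))))
  have h2 := h.tendsto x
  have h3 : hn (-x + x + bb (-x) x) = 0 := by
    have := dist_self (coords.symm x)
    exact this
  rw [h3] at h2
  exact h2

theorem continuous_crd : Continuous (coords : GG → (Fin 11 → ℝ)) := by
  rw [continuous_iff_continuousAt]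
  intro x
  have h1 : Filter.Tendsto (fun y : GG => (x⁻¹ * y).c) (𝓝 x) (𝓝 0) := by
    rw [tendsto_pi_nhds]
    intro i
    have hd : Filter.Tendsto (fun y : GG => dist x y ^ wt i) (𝓝 x) (𝓝 0) := by
      have : Continuous fun y : GG => dist x y ^ wt i := by fun_prop
      have h2 := this.tendsto x
      rwa [dist_self, zero_pow (by fin_cases i <;> decide)] at h2
    exact squeeze_zero_norm (fun y => abs_le_hn _ i) hd
  have h2 : Continuous fun u : Fin 11 → ℝ => x.c + u + bb x.c u :=
    contDiff_mul.continuous.comp (by fun_prop :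
      Continuous fun u : Fin 11 → ℝ => ((x.c, u) : (Fin 11 → ℝ) × (Fin 11 → ℝ)))
  have h3 := (h2.tendsto 0).comp h1
  have h4 : ∀ y : GG, x.c + (x⁻¹ * y).c + bb x.c (x⁻¹ * y).c = y.c := by
    intro y
    rw [← mul_c]
    simp
  have h5 : x.c + 0 + bb x.c 0 = x.c := by
    have := congrArg GG.c (mul_one x)
    exact this
  rw [h5] at h3
  refine h3.congr fun y => ?_
  exact h4 y

theorem gen : Subgroup.closure {x : GG | ∀ i, wt i ≠ 1 → x.c i = 0} = ⊤ := by
  rw [eq_top_iff]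
  intro g _
  set H := Subgroup.closure {x : GG | ∀ i, wt i ≠ 1 → x.c i = 0} with hH
  have hor : ∀ x : GG, x.c 9 = 0 → x.c 10 = 0 → x ∈ H := by
    intro x h9 h10
    apply Subgroup.subset_closure
    intro i hi
    fin_cases i
    all_goals first
      | exact absurd rfl hi
      | exact h9
      | exact h10
  have e : g = (⟨![g.c 0, g.c 1, g.c 2, g.c 3, g.c 4, g.c 5, g.c 6, g.c 7, g.c 8, 0, 0]⟩ : GG) *
      ((⟨![0, 0, 0, 3 * g.c 9, 0, 0, 0, 0, 0, 0, 0]⟩ : GG) *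
        ⟨![0, 0, 0, 0, 1, 0, 0, 0, 0, 0, 0]⟩ *
        ⟨![0, 0, 0, -(3 * g.c 9), -1, 0, 0, 0, 0, 0, 0]⟩) *
      ((⟨![0, 0, 0, 0, 0, 3 * g.c 10, 0, 0, 0, 0, 0]⟩ : GG) *
        ⟨![0, 0, 0, 0, 0, 0, 1, 0, 0, 0, 0]⟩ *
        ⟨![0, 0, 0, 0, 0, -(3 * g.c 10), -1, 0, 0, 0, 0]⟩) := by
    apply GG.ext
    simp only [mul_c]
    apply ext11 <;> simp [bb, om1, om2]
  rw [e]
  refine H.mul_mem (H.mul_mem (hor _ rfl rfl) (H.mul_mem (H.mul_mem (hor _ rfl rfl)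
    (hor _ rfl rfl)) (hor _ rfl rfl))) (H.mul_mem (H.mul_mem (hor _ rfl rfl)
    (hor _ rfl rfl)) (hor _ rfl rfl))

theorem dil (lam : ℝ) (x y : Fin 11 → ℝ) :
    (fun i => lam ^ wt i * (x + y + bb x y) i) =
      (fun i => lam ^ wt i * x i) + (fun i => lam ^ wt i * y i) +
        bb (fun i => lam ^ wt i * x i) (fun i => lam ^ wt i * y i) := by
  apply ext11 <;> simp [bb, om1, om2, wt] <;> ring

theorem hn_dil (lam : ℝ) (hl : 0 ≤ lam) (x : Fin 11 → ℝ) :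
    hn (fun i => lam ^ wt i * x i) = lam * hn x := by
  have e : psi (fun i => lam ^ wt i * x i) = lam • psi x := by
    apply ext11 <;> simp [psi, wt, abs_mul, Real.sqrt_sq hl]
  unfold hn
  rw [e, norm_smul, Real.norm_eq_abs, abs_of_nonneg hl]

/-- The Carnot structure. -/
noncomputable def CS : CarnotStructure 11 GG where
  φ := coords
  w := wt
  w_pos := by intro i; fin_cases i <;> decide
  continuous_coords := continuous_crd
  continuous_coords_symm := continuous_symm
  coords_one := rfl
  coords_inv _ := rfl
  smooth_mul := contDiff_mul
  dil_mul lam x y := GG.ext (dil lam x.c y.c)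
  horizontal_gen := gen
  dist_left_invariant z x y := by
    rw [dist_def, dist_def]
    congr 2
    group
  dist_homogeneous lam hl x y := by
    rw [dist_def, dist_def, ← hn_dil lam hl]
    congr 1
    have h := dil lam (x⁻¹).c y.c
    have hneg : (fun i => lam ^ wt i * (x⁻¹).c i) = -(fun i => lam ^ wt i * x.c i) := by
      funext i
      simp [inv_c]
    rw [hneg] at h
    exact h.symm

/-- The tangent groups. -/
def TT (p : GG) : Subgroup GG where
  carrier := {v | v.c 0 = p.c 1 * v.c 1}
  one_mem' := by simp [one_c]
  mul_mem' := by
    intro a b ha hb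
    simp only [Set.mem_ofPred_eq, mul_c, Pi.add_apply, bb0, bb1] at *
    rw [ha, hb]; ring
  inv_mem' := by
    intro a ha
    simp only [Set.mem_ofPred_eq, inv_c, Pi.neg_apply] at *
    rw [ha]; ring

/-- The hypersurface. -/
def SS : Set GG := {x | x.c 0 = x.c 1 ^ 2 / 2}

theorem xderiv_eq (i : Fin 11) (f : (Fin 11 → ℝ) → ℝ) (hf : Differentiable ℝ f) (x : GG) :
    CS.XDeriv i (fun g => f (CS.φ g)) x =
      fderiv ℝ f x.c (Pi.single i 1 + bb x.c (Pi.single i 1)) := by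
  have e : ∀ t : ℝ, x.c + t • (Pi.single i 1 : Fin 11 → ℝ) + bb x.c (t • Pi.single i 1) =
      x.c + t • (Pi.single i 1 + bb x.c (Pi.single i 1)) := by
    intro t
    apply ext11 <;> simp only [Pi.add_apply, Pi.smul_apply, smul_eq_mul, bb0, bb1, bb2, bb3,
      bb4, bb5, bb6, bb7, bb8, bb9, bb10, om1, om2] <;> ring
  have h1 : HasDerivAt (fun t : ℝ => x.c + t • (Pi.single i 1 + bb x.c (Pi.single i 1)))
      (Pi.single i 1 + bb x.c (Pi.single i 1)) 0 := by
    generalize (Pi.single i 1 + bb x.c (Pi.single i 1)) = w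
    simpa using ((hasDerivAt_id (0 : ℝ)).smul_const w).const_add x.c
  have h2 : HasFDerivAt f (fderiv ℝ f x.c)
      (x.c + (0 : ℝ) • (Pi.single i 1 + bb x.c (Pi.single i 1))) := by
    simpa using (hf x.c).hasFDerivAt
  have h3 := (h2.comp_hasDerivAt (0 : ℝ) h1).deriv
  rw [← h3]
  unfold CarnotStructure.XDeriv
  congr 1
  funext t
  show f (x.c + t • (Pi.single i 1 : Fin 11 → ℝ) + bb x.c (t • Pi.single i 1)) = _
  rw [e]
  rfl

theorem tangent_zero (p : GG) (hp : p ∈ SS) (U : Set GG) (f : (Fin 11 → ℝ) → ℝ)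
    (h : CS.IsDefiningAt SS p U f) (u : Fin 11 → ℝ) (hu : u 0 = p.c 1 * u 1) :
    fderiv ℝ f p.c u = 0 := by
  obtain ⟨hU, hpU, hf, hS, -⟩ := h
  have hf' : Differentiable ℝ f := hf.differentiable (by simp)
  set γ : ℝ → Fin 11 → ℝ := fun t =>
    p.c + t • u + t ^ 2 • (Pi.single 0 (u 1 ^ 2 / 2) : Fin 11 → ℝ) with hγ
  have hγ0 : γ 0 = p.c := by simp [hγ]
  have hd : HasDerivAt γ u 0 := by
    have := (((hasDerivAt_id (0 : ℝ)).smul_const u).const_add p.c).add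
      (((hasDerivAt_id (0 : ℝ)).pow 2).smul_const (Pi.single 0 (u 1 ^ 2 / 2) : Fin 11 → ℝ))
    exact this.congr_deriv (by simp)
  have hmem : ∀ t, coords.symm (γ t) ∈ SS := by
    intro t
    have hp' : p.c 0 = p.c 1 ^ 2 / 2 := hp
    show γ t 0 = γ t 1 ^ 2 / 2
    simp [hγ, hu, hp']
    ring
  have hc : Continuous γ := by fun_prop
  have hev : ∀ᶠ t in 𝓝 (0 : ℝ), coords.symm (γ t) ∈ U := by
    refine (continuous_symm.comp hc).continuousAt.eventually (hU.mem_nhds ?_)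
    show coords.symm (γ 0) ∈ U
    rw [hγ0]
    exact hpU
  have hz : (fun t => f (γ t)) =ᶠ[𝓝 0] fun _ => 0 := by
    filter_upwards [hev] with t ht
    have : coords.symm (γ t) ∈ SS ∩ U := ⟨hmem t, ht⟩
    rw [hS] at this
    exact this.1
  have h2 : HasFDerivAt f (fderiv ℝ f p.c) (γ 0) := by
    rw [hγ0]
    exact (hf' p.c).hasFDerivAt
  have h3 := (h2.comp_hasDerivAt (0 : ℝ) hd).deriv
  rw [← h3]
  have h4 := hz.deriv_eq
  rw [deriv_const] at h4
  exact h4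

theorem horiz_eq : CS.horiz = {0, 1, 2, 3, 4, 5, 6, 7, 8} := by
  unfold CarnotStructure.horiz
  show Finset.univ.filter (fun i => wt i = 1) = _
  decide

theorem T_eq (p : GG) (hp : p ∈ SS) (U : Set GG) (f : (Fin 11 → ℝ) → ℝ)
    (h : CS.IsNonCharDefiningAt SS p U f) : (TT p : Set GG) = CS.tangentSet f p := by
  have hd := h.1
  have tz := tangent_zero p hp U f hd
  have hf' : Differentiable ℝ f := hd.2.2.1.differentiable (by simp)
  have hne : fderiv ℝ f p.c ≠ 0 := hd.2.2.2.2 p hd.2.1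
  set D := fderiv ℝ f p.c with hD
  have hdec : ∀ u : Fin 11 → ℝ, D u = (u 0 - p.c 1 * u 1) * D (Pi.single 0 1) := by
    intro u
    have h1 := tz (u - (u 0 - p.c 1 * u 1) • Pi.single 0 1) (by simp)
    rw [map_sub, map_smul, smul_eq_mul] at h1
    linarith
  have h0 : D (Pi.single 0 1) ≠ 0 := by
    intro h0
    apply hne
    ext u
    rw [hdec, h0]
    simp
  have hX : ∀ i, CS.XDeriv i (fun g => f (CS.φ g)) p =
      ((Pi.single i 1 : Fin 11 → ℝ) 0 - p.c 1 * (Pi.single i 1 : Fin 11 → ℝ) 1) *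
        D (Pi.single 0 1) := by
    intro i
    rw [xderiv_eq i f hf', ← hD, hdec]
    simp [bb0, bb1]
  ext v
  unfold CarnotStructure.tangentSet
  rw [Set.mem_ofPred_eq, horiz_eq]
  simp only [hX]
  have : ∑ i ∈ ({0, 1, 2, 3, 4, 5, 6, 7, 8} : Finset (Fin 11)), CS.φ v i *
      (((Pi.single i 1 : Fin 11 → ℝ) 0 - p.c 1 * (Pi.single i 1 : Fin 11 → ℝ) 1) *
        D (Pi.single 0 1)) = (v.c 0 - p.c 1 * v.c 1) * D (Pi.single 0 1) := by
    have hv : ∀ i, CS.φ v i = v.c i := fun _ => rfl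
    simp [hv, Pi.single_apply]
    ring
  rw [this, mul_eq_zero, or_iff_left h0, sub_eq_zero]
  rfl

theorem smooth_nonchar : CS.IsSmoothNonCharHypersurface SS := by
  intro p _
  set f : (Fin 11 → ℝ) → ℝ := fun x => x 0 - x 1 ^ 2 / 2 with hf
  have hcd : ContDiff ℝ (⊤ : ℕ∞) f := by fun_prop
  have hdf : Differentiable ℝ f := hcd.differentiable (by simp)
  have hx : ∀ x : GG, CS.XDeriv 0 (fun g => f (CS.φ g)) x = 1 := by
    intro x
    have : (fun t : ℝ => (fun g => f (CS.φ g)) (x * CS.φ.symm (t • (Pi.single 0 1 : Fin 11 → ℝ))))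
        = fun t => t + f x.c := by
      funext t
      show f (x.c + t • (Pi.single 0 1 : Fin 11 → ℝ) + bb x.c (t • Pi.single 0 1)) = _
      simp [hf, bb0, bb1]
      ring
    unfold CarnotStructure.XDeriv
    rw [this]
    simp
  refine ⟨Set.univ, f, ⟨isOpen_univ, trivial, hcd, ?_, ?_⟩, ?_⟩
  · ext x
    simp only [Set.inter_univ, Set.mem_ofPred_eq]
    show x.c 0 = x.c 1 ^ 2 / 2 ↔ x.c 0 - x.c 1 ^ 2 / 2 = 0
    rw [sub_eq_zero]
  · intro x _ h0
    have h1 := hx x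
    rw [xderiv_eq 0 f hdf] at h1
    have h0' : fderiv ℝ f x.c = 0 := h0
    rw [h0'] at h1
    simp at h1
  · intro x _
    exact ⟨0, by rw [horiz_eq]; simp, by rw [hx]; exact one_ne_zero⟩

/-- Vertical elements. -/
def Z (p : GG) (a b : ℝ) : TT p :=
  ⟨⟨![0, 0, 0, 0, 0, 0, 0, 0, 0, a, b]⟩, show (0 : ℝ) = p.c 1 * 0 by simp⟩

theorem Zc (p : GG) (a b : ℝ) :
    (Z p a b).1.c = ![0, 0, 0, 0, 0, 0, 0, 0, 0, a, b] := rfl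

theorem Z_add (p : GG) (a b a' b' : ℝ) : Z p (a + a') (b + b') = Z p a b * Z p a' b' := by
  apply Subtype.ext
  apply GG.ext
  rw [Subgroup.coe_mul, mul_c, Zc, Zc, Zc]
  apply ext11 <;> simp only [Pi.add_apply, bb0, bb1, bb2, bb3, bb4, bb5, bb6, bb7, bb8, bb9,
    bb10, om1, om2] <;> simp

theorem Z_comm (p : GG) (a b : ℝ) (u : TT p) : Z p a b * u = u * Z p a b := by
  apply Subtype.ext
  apply GG.ext
  rw [Subgroup.coe_mul, mul_c, Subgroup.coe_mul, mul_c, Zc]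
  apply ext11 <;> simp only [Pi.add_apply, bb0, bb1, bb2, bb3, bb4, bb5, bb6, bb7, bb8, bb9,
    bb10, om1, om2] <;> simp <;> ring

theorem comm_eq (p : GG) (u v : TT p) :
    u * v = v * u * Z p (2 / 3 * om1 u.1.c v.1.c) (2 / 3 * om2 u.1.c v.1.c) := by
  apply Subtype.ext
  apply GG.ext
  simp only [Subgroup.coe_mul, mul_c, Zc]
  apply ext11 <;> simp only [Pi.add_apply, bb0, bb1, bb2, bb3, bb4, bb5, bb6, bb7, bb8, bb9,
    bb10, om1, om2] <;> simp <;> ring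

theorem Z_inj (p : GG) {a b a' b' : ℝ} (h : Z p a b = Z p a' b') : a = a' ∧ b = b' := by
  have h1 : (Z p a b).1.c = (Z p a' b').1.c := by rw [h]
  exact ⟨congrFun h1 9, congrFun h1 10⟩

/-- The four distinguished directions. -/
def cc (s : ℝ) : Fin 4 → ℝ × ℝ := ![(1, 0), (0, 1), (1, 1), (1, s)]

theorem mkmem (p : GG) (x : Fin 11 → ℝ) (h : x 0 = p.c 1 * x 1) : (⟨x⟩ : GG) ∈ TT p := h

/-- A non-vertical element realises one of the four directions as a bracket. -/
theorem exists_dir (p : GG) (u : TT p)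
    (h : ¬ (u.1.c 1 = 0 ∧ u.1.c 2 = 0 ∧ u.1.c 3 = 0 ∧ u.1.c 4 = 0 ∧ u.1.c 5 = 0 ∧ u.1.c 6 = 0 ∧
      u.1.c 7 = 0 ∧ u.1.c 8 = 0)) :
    ∃ (j : Fin 4) (v : TT p), (om1 u.1.c v.1.c, om2 u.1.c v.1.c) = cc (p.c 1) j := by
  have hu : u.1.c 0 = p.c 1 * u.1.c 1 := u.2
  by_cases h1 : u.1.c 1 = 0
  swap
  · refine ⟨3, ⟨⟨![0, 0, (u.1.c 1)⁻¹, 0, 0, 0, 0, 0, 0, 0, 0]⟩, mkmem _ _ (by simp)⟩, ?_⟩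
    simp [om1, om2, cc, hu, h1]
  by_cases h2 : u.1.c 2 = 0
  swap
  · refine ⟨3, ⟨⟨![-(p.c 1 * (u.1.c 2)⁻¹), -(u.1.c 2)⁻¹, 0, 0, 0, 0, 0, 0, 0, 0, 0]⟩,
      mkmem _ _ (by simp)⟩, ?_⟩
    simp [om1, om2, cc, h2]
    field_simp
  by_cases h3 : u.1.c 3 = 0
  swap
  · refine ⟨0, ⟨⟨![0, 0, 0, 0, (u.1.c 3)⁻¹, 0, 0, 0, 0, 0, 0]⟩, mkmem _ _ (by simp)⟩, ?_⟩
    simp [om1, om2, cc, h3]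
  by_cases h4 : u.1.c 4 = 0
  swap
  · refine ⟨0, ⟨⟨![0, 0, 0, -(u.1.c 4)⁻¹, 0, 0, 0, 0, 0, 0, 0]⟩, mkmem _ _ (by simp)⟩, ?_⟩
    simp [om1, om2, cc, h4]
  by_cases h5 : u.1.c 5 = 0
  swap
  · refine ⟨1, ⟨⟨![0, 0, 0, 0, 0, 0, (u.1.c 5)⁻¹, 0, 0, 0, 0]⟩, mkmem _ _ (by simp)⟩, ?_⟩
    simp [om1, om2, cc, h5]
  by_cases h6 : u.1.c 6 = 0
  swap
  · refine ⟨1, ⟨⟨![0, 0, 0, 0, 0, -(u.1.c 6)⁻¹, 0, 0, 0, 0, 0]⟩, mkmem _ _ (by simp)⟩, ?_⟩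
    simp [om1, om2, cc, h6]
  by_cases h7 : u.1.c 7 = 0
  swap
  · refine ⟨2, ⟨⟨![0, 0, 0, 0, 0, 0, 0, 0, (u.1.c 7)⁻¹, 0, 0]⟩, mkmem _ _ (by simp)⟩, ?_⟩
    simp [om1, om2, cc, h7]
  by_cases h8 : u.1.c 8 = 0
  swap
  · refine ⟨2, ⟨⟨![0, 0, 0, 0, 0, 0, 0, -(u.1.c 8)⁻¹, 0, 0, 0]⟩, mkmem _ _ (by simp)⟩, ?_⟩
    simp [om1, om2, cc, h8]
  exact absurd ⟨h1, h2, h3, h4, h5, h6, h7, h8⟩ h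

/-- Central elements are vertical. -/
theorem central_eq (p : GG) (u : TT p) (h : ∀ v : TT p, u * v = v * u) :
    u = Z p (u.1.c 9) (u.1.c 10) := by
  have hu : u.1.c 0 = p.c 1 * u.1.c 1 := u.2
  have key : u.1.c 1 = 0 ∧ u.1.c 2 = 0 ∧ u.1.c 3 = 0 ∧ u.1.c 4 = 0 ∧ u.1.c 5 = 0 ∧ u.1.c 6 = 0 ∧
      u.1.c 7 = 0 ∧ u.1.c 8 = 0 := by
    by_contra hc
    obtain ⟨j, v, hv⟩ := exists_dir p u hc
    have h1 := comm_eq p u v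
    rw [h v, left_eq_mul] at h1
    have h2 : Z p (2 / 3 * om1 u.1.c v.1.c) (2 / 3 * om2 u.1.c v.1.c) = Z p 0 0 := by
      rw [h1]
      apply Subtype.ext
      apply GG.ext
      apply ext11 <;> rfl
    obtain ⟨h3, h4⟩ := Z_inj p h2
    have h5 : om1 u.1.c v.1.c = 0 := by linarith
    have h6 : om2 u.1.c v.1.c = 0 := by linarith
    rw [h5, h6] at hv
    fin_cases j <;> simp [cc] at hv
  obtain ⟨h1, h2, h3, h4, h5, h6, h7, h8⟩ := key
  rw [h1, mul_zero] at hu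
  apply Subtype.ext
  apply GG.ext
  apply ext11 <;> first | assumption | rfl

/-- Cross-ratio argument. -/
theorem cross (s s' : ℝ) (hs : 2 < s) (hs' : 2 < s') (α β γ δ : ℝ) (hD : α * δ - β * γ ≠ 0)
    (h : ∀ i, ∃ j t, cc s' j =
      (t * (α * (cc s i).1 + β * (cc s i).2), t * (γ * (cc s i).1 + δ * (cc s i).2))) :
    s = s' := by
  choose σ t h using h
  have hdet : ∀ i j, (cc s' (σ i)).1 * (cc s' (σ j)).2 - (cc s' (σ i)).2 * (cc s' (σ j)).1 =
      t i * t j * (α * δ - β * γ) * ((cc s i).1 * (cc s j).2 - (cc s i).2 * (cc s j).1) := by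
    intro i j
    rw [h i, h j]
    ring
  have ht : ∀ i, t i ≠ 0 := by
    intro i hi
    have := h i
    rw [hi] at this
    generalize σ i = k at this
    fin_cases k <;> simp [cc] at this
  have h01 := hdet 0 1
  have h02 := hdet 0 2
  have h03 := hdet 0 3
  have h12 := hdet 1 2
  have h13 := hdet 1 3
  have h23 := hdet 2 3
  have ht0 := ht 0
  have ht1 := ht 1
  have ht2 := ht 2
  have ht3 := ht 3
  clear hdet h ht
  generalize σ 0 = a at *
  generalize σ 1 = b at *
  generalize σ 2 = c at *
  generalize σ 3 = d at *
  generalize t 0 = t0 at *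
  generalize t 1 = t1 at *
  generalize t 2 = t2 at *
  generalize t 3 = t3 at *
  generalize α * δ - β * γ = D at *
  have c0 : ∀ r, cc r 0 = (1, 0) := fun _ => rfl
  have c1 : ∀ r, cc r 1 = (0, 1) := fun _ => rfl
  have c2 : ∀ r, cc r 2 = (1, 1) := fun _ => rfl
  have c3 : ∀ r, cc r 3 = (1, r) := fun _ => rfl
  simp only [c0 s, c1 s, c2 s, c3 s] at *
  have hab : a ≠ b := by
    rintro rfl
    have : t0 * t1 * D = 0 := by linarith
    simp_all
  have hac : a ≠ c := by
    rintro rfl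
    have : t0 * t2 * D = 0 := by linarith
    simp_all
  have hbc : b ≠ c := by
    rintro rfl
    have : t1 * t2 * D = 0 := by linarith
    simp_all
  have had : a ≠ d := by
    rintro rfl
    have : t0 * t3 * D * s = 0 := by linarith
    have : s ≠ 0 := by linarith
    simp_all
  have hbd : b ≠ d := by
    rintro rfl
    have : t1 * t3 * D = 0 := by linarith
    simp_all
  have hcd : c ≠ d := by
    rintro rfl
    have : t2 * t3 * D * (s - 1) = 0 := by linarith
    have : s - 1 ≠ 0 := by linarith
    simp_all
  have key : s * (((cc s' a).1 * (cc s' c).2 - (cc s' a).2 * (cc s' c).1) *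
      ((cc s' b).1 * (cc s' d).2 - (cc s' b).2 * (cc s' d).1)) =
      ((cc s' a).1 * (cc s' d).2 - (cc s' a).2 * (cc s' d).1) *
      ((cc s' b).1 * (cc s' c).2 - (cc s' b).2 * (cc s' c).1) := by
    rw [h02, h13, h03, h12]
    ring
  clear h01 h02 h03 h12 h13 h23
  fin_cases a <;> fin_cases b <;> first | exact absurd rfl hab | skip
  all_goals fin_cases c <;> first | exact absurd rfl hac | exact absurd rfl hbc | skip
  all_goals fin_cases d <;> first
    | exact absurd rfl had | exact absurd rfl hbd | exact absurd rfl hcd | skip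
  all_goals
    simp [cc] at key
    first
      | linarith
      | nlinarith

theorem noniso (p q : GG) (hp : 2 < p.c 1) (hq : 2 < q.c 1) (e : TT p ≃* TT q)
    (he : Continuous e) : p.c 1 = q.c 1 := by
  have hcen : ∀ a b, e (Z p a b) = Z q ((e (Z p a b)).1.c 9) ((e (Z p a b)).1.c 10) := by
    intro a b
    apply central_eq
    intro v
    obtain ⟨w, rfl⟩ := e.surjective v
    rw [← map_mul, ← map_mul, Z_comm]
  let C0 : ℝ × ℝ →+ ℝ × ℝ := AddMonoidHom.mk' (fun z =>
    ((e (Z p z.1 z.2)).1.c 9, (e (Z p z.1 z.2)).1.c 10)) (by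
      intro z z'
      have h1 := hcen (z + z').1 (z + z').2
      have h2 : e (Z p (z + z').1 (z + z').2) = e (Z p z.1 z.2) * e (Z p z'.1 z'.2) := by
        rw [← map_mul, ← Z_add]; rfl
      have h3 := h2
      rw [h1, hcen z.1 z.2, hcen z'.1 z'.2, ← Z_add] at h3
      obtain ⟨h4, h5⟩ := Z_inj q h3
      exact Prod.ext h4 h5)
  have hcc : Continuous (fun x : TT q => x.1.c) := continuous_crd.comp continuous_subtype_val
  have hZ : Continuous fun z : ℝ × ℝ => Z p z.1 z.2 := by
    refine Continuous.subtype_mk (continuous_symm.comp (continuous_pi fun i => ?_)) _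
    fin_cases i <;> simp <;> fun_prop
  have hC : Continuous C0 := by
    have h1 : Continuous fun z : ℝ × ℝ => (e (Z p z.1 z.2)).1.c := hcc.comp (he.comp hZ)
    exact ((continuous_apply 9).comp h1).prodMk ((continuous_apply 10).comp h1)
  let C := C0.toRealLinearMap hC
  have hCe : ∀ a b, e (Z p a b) = Z q (C (a, b)).1 (C (a, b)).2 := hcen
  set α := (C (1, 0)).1
  set β := (C (0, 1)).1
  set γ := (C (1, 0)).2
  set δ := (C (0, 1)).2
  have hform : ∀ a b, C (a, b) = (α * a + β * b, γ * a + δ * b) := by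
    intro a b
    have : ((a, b) : ℝ × ℝ) = a • ((1, 0) : ℝ × ℝ) + b • ((0, 1) : ℝ × ℝ) := by simp
    rw [this, map_add, map_smul, map_smul]
    ext <;> simp [α, β, γ, δ] <;> ring
  have hinj : ∀ a b, C (a, b) = 0 → a = 0 ∧ b = 0 := by
    intro a b h
    have h1 := hCe a b
    have h2 := hCe 0 0
    have h3 : C ((0 : ℝ), (0 : ℝ)) = 0 := map_zero C
    rw [h] at h1
    rw [h3, ← h1] at h2
    exact Z_inj p (e.injective h2.symm)
  refine cross _ _ hp hq α β γ δ ?_ ?_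
  · intro hD
    obtain ⟨h1, h2⟩ := hinj δ (-γ) (by
      rw [hform]; ext
      · show α * δ + β * -γ = 0
        linarith
      · show γ * δ + δ * -γ = 0
        ring)
    obtain ⟨h3, h4⟩ := hinj β (-α) (by
      rw [hform]; ext
      · show α * β + β * -α = 0
        ring
      · show γ * β + δ * -α = 0
        linarith)
    obtain ⟨h5, h6⟩ := hinj 1 0 (by
      rw [hform, neg_eq_zero.1 h4, h3, neg_eq_zero.1 h2, h1]; simp)
    exact one_ne_zero h5
  · -- bracket compatibility
    have hbr : ∀ u v : TT p, C (om1 u.1.c v.1.c, om2 u.1.c v.1.c) =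
        (om1 (e u).1.c (e v).1.c, om2 (e u).1.c (e v).1.c) := by
      intro u v
      have h1 := comm_eq p u v
      have h2 := comm_eq q (e u) (e v)
      have h3 := congrArg e h1
      rw [map_mul, map_mul, map_mul, h2, mul_right_inj, hCe] at h3
      obtain ⟨h4, h5⟩ := Z_inj q h3
      rw [hform] at h4 h5 ⊢
      simp only at h4 h5
      ext
      · show _ * _ + _ * _ = _
        linarith
      · show _ * _ + _ * _ = _
        linarith
    have main : ∀ (i : Fin 4) (u : TT p),
        (∀ v : TT p, ∃ t : ℝ, (om1 u.1.c v.1.c, om2 u.1.c v.1.c) = t • cc (p.c 1) i) →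
        (∃ k : Fin 11, k.1 < 9 ∧ u.1.c k ≠ 0) →
        ∃ j t, cc (q.c 1) j = (t * (α * (cc (p.c 1) i).1 + β * (cc (p.c 1) i).2),
          t * (γ * (cc (p.c 1) i).1 + δ * (cc (p.c 1) i).2)) := by
      intro i u hu hk
      by_cases hz : ((e u).1.c 1 = 0 ∧ (e u).1.c 2 = 0 ∧ (e u).1.c 3 = 0 ∧ (e u).1.c 4 = 0 ∧
        (e u).1.c 5 = 0 ∧ (e u).1.c 6 = 0 ∧ (e u).1.c 7 = 0 ∧ (e u).1.c 8 = 0)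
      · exfalso
        obtain ⟨h1, h2, h3, h4, h5, h6, h7, h8⟩ := hz
        have h0 : (e u).1.c 0 = q.c 1 * (e u).1.c 1 := (e u).2
        rw [h1, mul_zero] at h0
        have hv : e u = Z q ((e u).1.c 9) ((e u).1.c 10) := by
          apply Subtype.ext
          apply GG.ext
          apply ext11 <;> first | assumption | rfl
        have hcu : ∀ v, u * v = v * u := by
          intro v
          apply e.injective
          rw [map_mul, map_mul, hv, Z_comm]
        have hu2 := central_eq p u hcu
        obtain ⟨k, hk9, hk0⟩ := hk
        apply hk0
        rw [hu2]
        fin_cases k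
        all_goals first
          | rfl
          | exact absurd hk9 (by decide)
      · obtain ⟨j, v, hv⟩ := exists_dir q (e u) hz
        obtain ⟨w, rfl⟩ := e.surjective v
        obtain ⟨t, ht⟩ := hu w
        refine ⟨j, t, ?_⟩
        rw [← hv, ← hbr, ht, map_smul]
        have := hform (cc (p.c 1) i).1 (cc (p.c 1) i).2
        rw [Prod.mk.eta] at this
        rw [this]
        rfl
    intro i
    fin_cases i
    · refine main 0 ⟨⟨![0, 0, 0, 1, 0, 0, 0, 0, 0, 0, 0]⟩, mkmem _ _ (by simp)⟩ ?_
        ⟨3, by decide, by simp⟩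
      intro v
      exact ⟨v.1.c 4, by simp [om1, om2, cc]⟩
    · refine main 1 ⟨⟨![0, 0, 0, 0, 0, 1, 0, 0, 0, 0, 0]⟩, mkmem _ _ (by simp)⟩ ?_
        ⟨5, by decide, by simp⟩
      intro v
      exact ⟨v.1.c 6, by simp [om1, om2, cc]⟩
    · refine main 2 ⟨⟨![0, 0, 0, 0, 0, 0, 0, 1, 0, 0, 0]⟩, mkmem _ _ (by simp)⟩ ?_
        ⟨7, by decide, by simp⟩
      intro v
      exact ⟨v.1.c 8, by simp [om1, om2, cc]⟩
    · refine main 3 ⟨⟨![0, 0, 1, 0, 0, 0, 0, 0, 0, 0, 0]⟩, mkmem _ _ (by simp)⟩ ?_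
        ⟨2, by decide, by simp⟩
      intro v
      have hv : v.1.c 0 = p.c 1 * v.1.c 1 := v.2
      exact ⟨-v.1.c 1, by simp [om1, om2, cc, hv]; ring⟩

/-- Parametrisation of the uncountable set of points. -/
noncomputable def pt (s : ℝ) : GG := ⟨![s ^ 2 / 2, s, 0, 0, 0, 0, 0, 0, 0, 0, 0]⟩

theorem pt1 (s : ℝ) : (pt s).c 1 = s := rfl

theorem pt_inj : Function.Injective pt := by
  intro s t h
  rw [← pt1 s, h, pt1]

end Ex6

/-- there exist a Carnot group `G` and a `C^∞` non-characteristic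
hypersurface `S ⊆ G` such that `{T_p^I S}_{p ∈ S}` contains uncountably many pairwise
non-isomorphic Carnot groups. -/
theorem stmt6 :
    ∃ (n : ℕ) (G : Type) (g1 : Group G) (m1 : MetricSpace G),
      Nonempty (@Stmt6Witness n G g1 m1) := by
  refine ⟨11, Ex6.GG, inferInstance, inferInstance, ⟨{
    C := Ex6.CS
    S := Ex6.SS
    smooth_nonchar := Ex6.smooth_nonchar
    T := Ex6.TT
    T_eq := Ex6.T_eq
    P := Ex6.pt '' Set.Ioi 2
    P_sub := ?_
    P_uncountable := ?_
    pairwise_noniso := ?_ }⟩⟩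
  · rintro _ ⟨s, -, rfl⟩
    rfl
  · intro h
    have h2 := Set.countable_of_injective_of_countable_image (Ex6.pt_inj.injOn) h
    have h3 := Cardinal.mk_Ioi_real 2
    rw [← Cardinal.le_aleph0_iff_set_countable, h3] at h2
    exact absurd h2 (not_le.2 Cardinal.aleph0_lt_continuum)
  · rintro _ ⟨s, hs, rfl⟩ _ ⟨t, ht, rfl⟩ hne ⟨e, he, -⟩
    apply hne
    have := Ex6.noniso (Ex6.pt s) (Ex6.pt t) hs ht e he
    rw [Ex6.pt1, Ex6.pt1] at this
    rw [this]
end
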